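/- arXiv:1809.03459 — 3 statements merged into one kernel-verified Lean document; each statement's English description precedes it below -/
import Mathlib

section
/- Fix i ∈ {1,…,N} and a constant A ∈ ℝ, and define w : ℝ^N → ℝ by w(x) = p_N(x̃^i) + A·cosh(β·x̃^i), where x̃^i = x^i − (Σ_{j≠i} x^j)/(N−1) and β = √(2(N−1)α/N). Then w is twice continuously differentiable on ℝ^N and satisfies −α·w(x) + h(((N−1)/N)·x̃^i) + (1/2)·Σ_{j=1}^N ∂²w/∂(x^j)²(x) = 0 for all x ∈ ℝ^N. -/
open MeasureTheory Real Set Filter Topology ProbabilityTheory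

/-- The discounted expected cost functional defining `p_N`. -/
noncomputable def pN (N : ℕ) (α : ℝ) (h : ℝ → ℝ) : ℝ → ℝ := fun x =>
  ∫ t in Ioi (0:ℝ), Real.exp (-α * t) *
    ∫ u, h (((N:ℝ) - 1) / N * x + u) ∂(gaussianReal 0 (((N:ℝ) - 1) / N * t).toNNReal)

/-- Second partial derivative of `w` in the `j`-th coordinate at `x`. -/
noncomputable def secondPartial {N : ℕ} (w : (Fin N → ℝ) → ℝ) (j : Fin N)
    (x : Fin N → ℝ) : ℝ :=
  deriv (deriv (fun t => w (Function.update x j t))) (x j)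

lemma abs_sub_le_of_abs_deriv_le {f f' B : ℝ → ℝ} (hf : ∀ x, HasDerivAt f (f' x) x)
    (hB : MonotoneOn B (Ici 0)) (hf' : ∀ x, |f' x| ≤ B |x|) (x : ℝ) :
    |f x - f 0| ≤ B |x| * |x| := by
  have := (convex_closedBall (0 : ℝ) |x|).norm_image_sub_le_of_norm_hasDerivWithin_le
    (f := f) (f' := f') (C := B |x|) (x := 0) (y := x)
    (fun y _ => (hf y).hasDerivWithinAt)
    (fun y hy => (hf' y).trans (hB (abs_nonneg y) (abs_nonneg x) (by simpa using hy)))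
    (by simp) (by simp)
  simpa using this

section Weighted

variable {Ω : Type*} [MeasurableSpace Ω] {μ : Measure Ω} {g X : Ω → ℝ} {f f' : ℝ → ℝ} {C : ℝ}

lemma integrable_mul_comp_add (hg : Integrable g μ) (hgX : Integrable (fun ω => g ω * X ω ^ 2) μ)
    (hX : AEStronglyMeasurable X μ) (hf : Continuous f) (hC : ∀ x, |f x| ≤ C * (1 + x ^ 2))
    (y : ℝ) : Integrable (fun ω => g ω * f (y + X ω)) μ := by
  have hC0 : 0 ≤ C := by simpa using (abs_nonneg _).trans (hC 0)
  refine ((hg.norm.const_mul (C * (1 + 2 * y ^ 2))).add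
    (hgX.norm.const_mul (C * 2))).mono'
    (hg.aestronglyMeasurable.mul
      (hf.comp_aestronglyMeasurable (aestronglyMeasurable_const.add hX)))
    (Eventually.of_forall fun ω => ?_)
  have h1 : |f (y + X ω)| ≤ C * (1 + 2 * y ^ 2 + 2 * X ω ^ 2) :=
    (hC _).trans (mul_le_mul_of_nonneg_left (by nlinarith [sq_nonneg (y - X ω)]) hC0)
  simp only [norm_mul, Real.norm_eq_abs, Pi.add_apply, abs_pow, sq_abs]
  nlinarith [mul_le_mul_of_nonneg_left h1 (abs_nonneg (g ω))]

lemma hasDerivAt_integral_mul_comp_add (hg : Integrable g μ)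
    (hgX : Integrable (fun ω => g ω * X ω ^ 2) μ) (hX : AEStronglyMeasurable X μ)
    (hf : ∀ x, HasDerivAt f (f' x) x) (hf' : Continuous f') (hC : ∀ x, |f x| ≤ C * (1 + x ^ 2))
    (hC' : ∀ x, |f' x| ≤ C * (1 + x ^ 2)) (y : ℝ) :
    HasDerivAt (fun y => ∫ ω, g ω * f (y + X ω) ∂μ) (∫ ω, g ω * f' (y + X ω) ∂μ) y := by
  have hC0 : 0 ≤ C := by simpa using (abs_nonneg _).trans (hC 0)
  have hfc : Continuous f := continuous_iff_continuousAt.2 fun x => (hf x).continuousAt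
  have hint := fun y => integrable_mul_comp_add hg hgX hX hfc hC y
  refine (hasDerivAt_integral_of_dominated_loc_of_deriv_le (s := Metric.ball y 1)
    (F := fun y ω => g ω * f (y + X ω)) (F' := fun y ω => g ω * f' (y + X ω))
    (bound := fun ω => (C * (1 + 2 * (|y| + 1) ^ 2)) * ‖g ω‖ + C * 2 * ‖g ω * X ω ^ 2‖)
    (Metric.ball_mem_nhds y one_pos) (Eventually.of_forall fun y => (hint y).aestronglyMeasurable)
    (hint y) (integrable_mul_comp_add hg hgX hX hf' hC' y).aestronglyMeasurable
    (Eventually.of_forall fun ω z hz => ?_)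
    ((hg.norm.const_mul _).add (hgX.norm.const_mul _))
    (Eventually.of_forall fun ω z _ => ?_)).2
  · have hz' : z ^ 2 ≤ (|y| + 1) ^ 2 := by
      rw [← sq_abs z]
      have : |z - y| < 1 := by simpa [Real.dist_eq] using hz
      have : |z| ≤ |y| + 1 := by linarith [abs_sub_abs_le_abs_sub z y]
      gcongr
    have h1 : |f' (z + X ω)| ≤ C * (1 + 2 * (|y| + 1) ^ 2 + 2 * X ω ^ 2) :=
      (hC' _).trans (mul_le_mul_of_nonneg_left (by nlinarith [sq_nonneg (z - X ω)]) hC0)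
    simp only [norm_mul, Real.norm_eq_abs, abs_pow, sq_abs]
    nlinarith [mul_le_mul_of_nonneg_left h1 (abs_nonneg (g ω))]
  · simpa using! ((hf (z + X ω)).comp_add_const z (X ω)).const_mul (g ω)

lemma continuous_integral_mul_comp_add (hg : Integrable g μ) (hX : AEStronglyMeasurable X μ)
    (hf : Continuous f) (hC : ∀ x, |f x| ≤ C) :
    Continuous fun y => ∫ ω, g ω * f (y + X ω) ∂μ := by
  refine continuous_of_dominated (bound := fun ω => ‖g ω‖ * C)
    (fun y => hg.aestronglyMeasurable.mul
      (hf.comp_aestronglyMeasurable (aestronglyMeasurable_const.add hX)))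
    (fun y => Eventually.of_forall fun ω => ?_) (hg.norm.mul_const C)
    (Eventually.of_forall fun ω => by fun_prop)
  rw [norm_mul]
  exact mul_le_mul_of_nonneg_left (hC _) (norm_nonneg _)

end Weighted

lemma integrable_sq_gaussianReal : Integrable (fun z : ℝ => z ^ 2) (gaussianReal 0 1) :=
  (memLp_id_gaussianReal 2).integrable_sq

lemma integrable_id_gaussianReal : Integrable (fun z : ℝ => z) (gaussianReal 0 1) :=
  (memLp_id_gaussianReal 1).integrable le_rfl

/-- Gaussian integration by parts for the standard normal law. -/
lemma integral_id_mul_gaussianReal {f f' : ℝ → ℝ} (hf : ∀ x, HasDerivAt f (f' x) x)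
    (hi : Integrable f (gaussianReal 0 1)) (hi' : Integrable f' (gaussianReal 0 1))
    (hxi : Integrable (fun z => z * f z) (gaussianReal 0 1)) :
    ∫ z, z * f z ∂(gaussianReal 0 1) = ∫ z, f' z ∂(gaussianReal 0 1) := by
  have key : ∀ u : ℝ → ℝ, Integrable u (gaussianReal 0 1) →
      Integrable fun z => gaussianPDFReal 0 1 z * u z := by
    intro u hu
    rw [gaussianReal_of_var_ne_zero _ one_ne_zero, integrable_withDensity_iff_integrable_smul'
      (measurable_gaussianPDF _ _) (Eventually.of_forall fun _ => gaussianPDF_lt_top)] at hu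
    simpa [toReal_gaussianPDF] using hu
  have hφ : ∀ z, HasDerivAt (gaussianPDFReal 0 1) (-(z * gaussianPDFReal 0 1 z)) z := by
    intro z
    have h1 : HasDerivAt (fun z : ℝ => -(z - 0) ^ 2 / (2 * ((1 : NNReal) : ℝ))) (-z) z := by
      have := ((((hasDerivAt_id z).sub_const 0).pow 2).neg.div_const (2 * ((1 : NNReal) : ℝ)))
      convert! this using 1
      simp
      ring
    have h2 := (h1.exp).const_mul (√(2 * π * ((1 : NNReal) : ℝ)))⁻¹
    rw [gaussianPDFReal_def]
    convert! h2 using 1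
    ring
  have h0 := integral_eq_zero_of_hasDerivAt_of_integrable
    (f := fun z => gaussianPDFReal 0 1 z * f z)
    (f' := fun z => gaussianPDFReal 0 1 z * f' z - gaussianPDFReal 0 1 z * (z * f z))
    (fun z => by
      convert! (hφ z).mul (hf z) using 1
      ring)
    ((key _ hi').sub (key _ hxi)) (key _ hi)
  rw [integral_sub (key _ hi') (key _ hxi)] at h0
  simp only [integral_gaussianReal_eq_integral_smul one_ne_zero, smul_eq_mul]
  linarith

/-- The scaled form of the heat equation for Gaussian averages. -/
lemma hasDerivAt_integral_comp_add_mul_gaussianReal {f f' f'' : ℝ → ℝ} {a K : ℝ}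
    (hf : ∀ x, HasDerivAt f (f' x) x) (hf' : ∀ x, HasDerivAt f' (f'' x) x)
    (hf'' : Continuous f'') (hb' : ∀ x, |f' x| ≤ a + K * |x|) (hb'' : ∀ x, |f'' x| ≤ K)
    (hi : ∀ y s : ℝ, Integrable (fun z => f (y + s * z)) (gaussianReal 0 1)) (y s : ℝ) :
    HasDerivAt (fun s => ∫ z, f (y + s * z) ∂(gaussianReal 0 1))
      (s * ∫ z, f'' (y + s * z) ∂(gaussianReal 0 1)) s := by
  have hK : 0 ≤ K := (abs_nonneg _).trans (hb'' 0)
  have hfc' : Continuous f' := continuous_iff_continuousAt.2 fun x => (hf' x).continuousAt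
  have hbound : ∀ r, |r| ≤ |s| + 1 → ∀ z,
      |f' (y + r * z)| ≤ (a + K * |y|) + K * (|s| + 1) * |z| := by
    intro r hr z
    have h1 : |y + r * z| ≤ |y| + (|s| + 1) * |z| := by
      calc |y + r * z| ≤ |y| + |r * z| := abs_add_le _ _
        _ ≤ _ := by rw [abs_mul]; gcongr
    nlinarith [hb' (y + r * z), mul_le_mul_of_nonneg_left h1 hK]
  have hs1 : |s| ≤ |s| + 1 := by linarith
  have hZ := integrable_id_gaussianReal
  have hZ2 := integrable_sq_gaussianReal
  have hdom : Integrable (fun z : ℝ => (a + K * |y|) * |z| + K * (|s| + 1) * z ^ 2)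
      (gaussianReal 0 1) := (hZ.norm.const_mul _).add (hZ2.const_mul _)
  have hdomle : ∀ r, |r| ≤ |s| + 1 → ∀ z,
      ‖z * f' (y + r * z)‖ ≤ (a + K * |y|) * |z| + K * (|s| + 1) * z ^ 2 := by
    intro r hr z
    rw [norm_mul, Real.norm_eq_abs, Real.norm_eq_abs, ← sq_abs z]
    nlinarith [mul_le_mul_of_nonneg_left (hbound r hr z) (abs_nonneg z)]
  have hmeas : AEStronglyMeasurable (fun z => z * f' (y + s * z)) (gaussianReal 0 1) :=
    (by fun_prop : Continuous fun z => z * f' (y + s * z)).aestronglyMeasurable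
  have hder := (hasDerivAt_integral_of_dominated_loc_of_deriv_le (s := Metric.ball s 1)
    (μ := gaussianReal 0 1)
    (F := fun s z => f (y + s * z)) (F' := fun s z => z * f' (y + s * z))
    (bound := fun z => (a + K * |y|) * |z| + K * (|s| + 1) * z ^ 2)
    (Metric.ball_mem_nhds s one_pos)
    (Eventually.of_forall fun s => (hi y s).aestronglyMeasurable) (hi y s) hmeas
    (Eventually.of_forall fun z r hr => hdomle r (by
      have : |r - s| < 1 := by simpa [Real.dist_eq] using hr
      linarith [abs_sub_abs_le_abs_sub r s]) z)
    hdom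
    (Eventually.of_forall fun z r _ => by
      have h1 : HasDerivAt (fun r : ℝ => y + r * z) z r := by
        simpa using ((hasDerivAt_id r).mul_const z).const_add y
      have h2 := (hf (y + r * z)).comp r h1
      convert! h2 using 1
      ring)).2
  have hstein := integral_id_mul_gaussianReal (f := fun z => f' (y + s * z))
    (f' := fun z => s * f'' (y + s * z))
    (fun z => by
      have h1 : HasDerivAt (fun z : ℝ => y + s * z) s z := by
        simpa using ((hasDerivAt_id z).const_mul s).const_add y
      have h2 := (hf' (y + s * z)).comp z h1
      convert! h2 using 1
      ring)
    (((integrable_const _).add (hZ.norm.const_mul (K * (|s| + 1)))).mono'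
      (by fun_prop : Continuous fun z => f' (y + s * z)).aestronglyMeasurable
      (Eventually.of_forall (hbound s hs1)))
    ((integrable_const (|s| * K)).mono'
      (by fun_prop : Continuous fun z => s * f'' (y + s * z)).aestronglyMeasurable
      (Eventually.of_forall fun z => by
        rw [norm_mul]
        exact mul_le_mul_of_nonneg_left (hb'' _) (norm_nonneg _)))
    (hdom.mono' hmeas (Eventually.of_forall (hdomle s hs1)))
  rw [hstein, integral_const_mul] at hder
  exact hder

lemma gaussianReal_zero_toNNReal_eq_map {v : ℝ} (hv : 0 ≤ v) :
    gaussianReal 0 v.toNNReal = (gaussianReal 0 1).map (√v * ·) := by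
  rw [gaussianReal_map_const_mul]
  congr 1
  · simp
  · ext
    simp [Real.sq_sqrt hv, hv]

/-- The `α`-resolvent of Brownian motion with variance rate `c`, applied to `f`. -/
noncomputable def brownianResolvent (c α : ℝ) (f : ℝ → ℝ) (y : ℝ) : ℝ :=
  ∫ p : ℝ × ℝ, exp (-α * p.1) * f (y + √(c * p.1) * p.2)
    ∂((volume.restrict (Ioi (0 : ℝ))).prod (gaussianReal 0 1))

section Resolvent

variable {c α : ℝ}

lemma integrable_exp_prod (hα : 0 < α) :
    Integrable (fun p : ℝ × ℝ => exp (-α * p.1))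
      ((volume.restrict (Ioi (0 : ℝ))).prod (gaussianReal 0 1)) := by
  simpa using Integrable.mul_prod (exp_neg_integrableOn_Ioi 0 hα)
    (integrable_const (μ := gaussianReal 0 1) (1 : ℝ))

lemma integrable_exp_mul_sq_prod (hα : 0 < α) (hc : 0 ≤ c) :
    Integrable (fun p : ℝ × ℝ => exp (-α * p.1) * (√(c * p.1) * p.2) ^ 2)
      ((volume.restrict (Ioi (0 : ℝ))).prod (gaussianReal 0 1)) := by
  have h1 : Integrable (fun t : ℝ => c * (t * exp (-α * t))) (volume.restrict (Ioi 0)) := by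
    have := integrableOn_rpow_mul_exp_neg_mul_rpow (p := 1) (s := 1) (b := α)
      (by norm_num) one_pos hα
    simpa [IntegrableOn] using this.const_mul c
  refine (Integrable.mul_prod h1 integrable_sq_gaussianReal).congr ?_
  have h2 : ∀ᵐ p : ℝ × ℝ ∂((volume.restrict (Ioi (0 : ℝ))).prod (gaussianReal 0 1)), 0 < p.1 :=
    Measure.quasiMeasurePreserving_fst.ae (ae_restrict_mem measurableSet_Ioi)
  filter_upwards [h2] with p hp
  rw [mul_pow, Real.sq_sqrt (by positivity)]
  ring

lemma integrable_brownianResolvent_integrand (hα : 0 < α) (hc : 0 ≤ c) {f : ℝ → ℝ} {C : ℝ}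
    (hf : Continuous f) (hC : ∀ x, |f x| ≤ C * (1 + x ^ 2)) (y : ℝ) :
    Integrable (fun p : ℝ × ℝ => exp (-α * p.1) * f (y + √(c * p.1) * p.2))
      ((volume.restrict (Ioi (0 : ℝ))).prod (gaussianReal 0 1)) :=
  integrable_mul_comp_add (X := fun p : ℝ × ℝ => √(c * p.1) * p.2) (integrable_exp_prod hα)
    (integrable_exp_mul_sq_prod hα hc) (by fun_prop) hf hC y

lemma brownianResolvent_eq_integral_integral (hα : 0 < α) (hc : 0 ≤ c) {f : ℝ → ℝ} {C : ℝ}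
    (hf : Continuous f) (hC : ∀ x, |f x| ≤ C * (1 + x ^ 2)) (y : ℝ) :
    brownianResolvent c α f y = ∫ t in Ioi (0 : ℝ), exp (-α * t) *
      ∫ z, f (y + √(c * t) * z) ∂(gaussianReal 0 1) := by
  rw [brownianResolvent, integral_prod _ (integrable_brownianResolvent_integrand hα hc hf hC y)]
  simp only [integral_const_mul]

lemma integrableOn_brownianResolvent_integrand (hα : 0 < α) (hc : 0 ≤ c) {f : ℝ → ℝ} {C : ℝ}
    (hf : Continuous f) (hC : ∀ x, |f x| ≤ C * (1 + x ^ 2)) (y : ℝ) :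
    IntegrableOn (fun t => exp (-α * t) * ∫ z, f (y + √(c * t) * z) ∂(gaussianReal 0 1))
      (Ioi (0 : ℝ)) := by
  have := (integrable_brownianResolvent_integrand hα hc hf hC y).integral_prod_left
  simpa only [IntegrableOn, integral_const_mul] using this

/-- The resolvent equation `α R f = f + (c / 2) R f''`. -/
lemma mul_brownianResolvent_eq (hα : 0 < α) (hc : 0 < c) {f f' f'' : ℝ → ℝ} {a K C : ℝ}
    (hf : ∀ x, HasDerivAt f (f' x) x) (hf' : ∀ x, HasDerivAt f' (f'' x) x)
    (hf'' : Continuous f'') (hC : ∀ x, |f x| ≤ C * (1 + x ^ 2))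
    (hb' : ∀ x, |f' x| ≤ a + K * |x|) (hb'' : ∀ x, |f'' x| ≤ K) (y : ℝ) :
    α * brownianResolvent c α f y = f y + c / 2 * brownianResolvent c α f'' y := by
  have hfc : Continuous f := continuous_iff_continuousAt.2 fun x => (hf x).continuousAt
  have hK : 0 ≤ K := (abs_nonneg _).trans (hb'' 0)
  have hC'' : ∀ x, |f'' x| ≤ K * (1 + x ^ 2) := fun x => (hb'' x).trans (by nlinarith [sq_nonneg x])
  have hi : ∀ y s : ℝ, Integrable (fun z => f (y + s * z)) (gaussianReal 0 1) := fun y s => by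
    simpa using integrable_mul_comp_add (g := fun _ => 1) (X := fun z => s * z)
      (integrable_const _) (by simpa [mul_pow] using integrable_sq_gaussianReal.const_mul (s ^ 2))
      (by fun_prop) hfc hC y
  have hheat := hasDerivAt_integral_comp_add_mul_gaussianReal hf hf' hf'' hb' hb'' hi y
  set G : ℝ → ℝ := fun s => ∫ z, f (y + s * z) ∂(gaussianReal 0 1) with hG
  set G₂ : ℝ → ℝ := fun s => ∫ z, f'' (y + s * z) ∂(gaussianReal 0 1)
  have hGc : Continuous G := continuous_iff_continuousAt.2 fun x => (hheat x).continuousAt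
  have hI := integrableOn_brownianResolvent_integrand hα hc.le hfc hC y
  have hI₂ := integrableOn_brownianResolvent_integrand hα hc.le hf'' hC'' y
  have hder : ∀ t ∈ Ioi (0 : ℝ), HasDerivAt (fun t => exp (-α * t) * G √(c * t))
      (c / 2 * (exp (-α * t) * G₂ √(c * t)) - α * (exp (-α * t) * G √(c * t))) t := by
    intro t ht
    have hct : 0 < c * t := mul_pos hc ht
    have h1 : HasDerivAt (fun t => √(c * t)) (c / (2 * √(c * t))) t := by
      simpa using ((hasDerivAt_id t).const_mul c).sqrt (by simpa using hct.ne')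
    have h2 : HasDerivAt (fun t => exp (-α * t)) (exp (-α * t) * (-α)) t := by
      simpa using ((hasDerivAt_id t).const_mul (-α)).exp
    have h3 := h2.mul ((hheat √(c * t)).comp t h1)
    convert! h3 using 1
    have : √(c * t) ≠ 0 := (Real.sqrt_pos.2 hct).ne'
    simp only [Function.comp]
    field_simp
    ring
  have hder_int := (hI₂.const_mul (c / 2)).sub (hI.const_mul α)
  have hlim := tendsto_zero_of_hasDerivAt_of_integrableOn_Ioi hder hder_int hI
  have hftc := integral_Ioi_of_hasDerivAt_of_tendsto
    (by fun_prop : Continuous fun t => exp (-α * t) * G √(c * t)).continuousWithinAt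
    hder hder_int hlim
  rw [integral_sub (hI₂.const_mul (c / 2)) (hI.const_mul α), integral_const_mul,
    integral_const_mul, ← brownianResolvent_eq_integral_integral hα hc.le hf'' hC'',
    ← brownianResolvent_eq_integral_integral hα hc.le hfc hC] at hftc
  simp [hG] at hftc
  linarith

end Resolvent

lemma pN_eq_brownianResolvent {N : ℕ} (hN : 1 ≤ N) {α C : ℝ} (hα : 0 < α) {h : ℝ → ℝ}
    (hh : Continuous h) (hC : ∀ x, |h x| ≤ C * (1 + x ^ 2)) (x : ℝ) :
    pN N α h x = brownianResolvent (((N : ℝ) - 1) / N) α h (((N : ℝ) - 1) / N * x) := by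
  have hc : 0 ≤ ((N : ℝ) - 1) / N :=
    div_nonneg (sub_nonneg.2 (by exact_mod_cast hN)) (Nat.cast_nonneg N)
  rw [brownianResolvent_eq_integral_integral hα hc hh hC, pN]
  refine setIntegral_congr_fun measurableSet_Ioi fun t ht => ?_
  have hct : 0 ≤ ((N : ℝ) - 1) / N * t := mul_nonneg hc (le_of_lt ht)
  rw [gaussianReal_zero_toNNReal_eq_map hct, integral_map (by fun_prop)
    (by fun_prop : Continuous _).aestronglyMeasurable]

lemma contDiff_two_of_hasDerivAt {f f' f'' : ℝ → ℝ} (hf : ∀ x, HasDerivAt f (f' x) x)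
    (hf' : ∀ x, HasDerivAt f' (f'' x) x) (hf'' : Continuous f'') : ContDiff ℝ 2 f := by
  have h1 : deriv f = f' := funext fun x => (hf x).deriv
  have h2 : deriv f' = f'' := funext fun x => (hf' x).deriv
  rw [show (2 : WithTop ℕ∞) = 1 + 1 by norm_num, contDiff_succ_iff_deriv]
  refine ⟨fun x => (hf x).differentiableAt, by simp, ?_⟩
  rw [h1, contDiff_one_iff_deriv, h2]
  exact ⟨fun x => (hf' x).differentiableAt, hf''⟩

lemma secondPartial_comp_of_affine {N : ℕ} {W W' W'' : ℝ → ℝ} (hW : ∀ x, HasDerivAt W (W' x) x)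
    (hW' : ∀ x, HasDerivAt W' (W'' x) x) {l : (Fin N → ℝ) → ℝ} {j : Fin N} {x : Fin N → ℝ} {d : ℝ}
    (hl : ∀ t, l (Function.update x j t) = l x + d * (t - x j)) :
    secondPartial (fun x => W (l x)) j x = d ^ 2 * W'' (l x) := by
  have haff : ∀ t, HasDerivAt (fun t => l x + d * (t - x j)) d t := fun t => by
    simpa using (((hasDerivAt_id t).sub_const (x j)).const_mul d).const_add (l x)
  have h1 : deriv (fun t => W (l x + d * (t - x j))) =
      fun t => W' (l x + d * (t - x j)) * d :=
    funext fun t => ((hW _).comp t (haff t)).deriv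
  simp only [secondPartial, hl]
  rw [h1]
  refine (((hW' _).comp (x j) (haff (x j))).mul_const d).deriv.trans ?_
  simp
  ring

/-- Under H2', the candidate value `w(x) = p_N(x̃^i) + A cosh(β x̃^i)` is `C²` and solves
`−α w + h(((N−1)/N) x̃^i) + (1/2) Σ_j ∂²w/∂(x^j)² = 0` on `ℝ^N`. -/
theorem candidate_value_solves_HJB (N : ℕ) (hN : 2 ≤ N) (α k K : ℝ) (hα : 0 < α)
    (hk : 0 < k) (hkK : k < K) (h : ℝ → ℝ) (hC2 : ContDiff ℝ 2 h)
    (heven : ∀ x, h (-x) = h x) (h0 : 0 ≤ h 0)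
    (hmono : AntitoneOn (deriv (deriv h)) (Set.Ici 0))
    (hlb : ∀ x, k ≤ deriv (deriv h) x) (hub : ∀ x, deriv (deriv h) x ≤ K)
    (i : Fin N) (A : ℝ) (β : ℝ) (hβ : β = Real.sqrt (2 * ((N:ℝ) - 1) * α / N))
    (xtil : (Fin N → ℝ) → ℝ)
    (hxtil : xtil = fun x => x i - (∑ j ∈ Finset.univ.erase i, x j) / ((N:ℝ) - 1))
    (w : (Fin N → ℝ) → ℝ)
    (hw : w = fun x => pN N α h (xtil x) + A * Real.cosh (β * xtil x)) :
    ContDiff ℝ 2 w ∧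
    ∀ x : Fin N → ℝ, -α * w x + h (((N:ℝ) - 1) / N * xtil x)
        + (1/2) * ∑ j : Fin N, secondPartial w j x = 0 := by
  have hN1 : (0 : ℝ) < (N : ℝ) - 1 := by
    have : (2 : ℝ) ≤ N := by exact_mod_cast hN
    linarith
  have hN0 : (0 : ℝ) < N := by linarith
  have hc : 0 < ((N : ℝ) - 1) / N := div_pos hN1 hN0
  have hd1 : ∀ x, HasDerivAt h (deriv h x) x := fun x =>
    (hC2.differentiable (by norm_num) x).hasDerivAt
  have hC1 : ContDiff ℝ 1 (deriv h) := by
    rw [show (2 : WithTop ℕ∞) = 1 + 1 by norm_num, contDiff_succ_iff_deriv] at hC2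
    exact hC2.2.2
  have hd2 : ∀ x, HasDerivAt (deriv h) (deriv (deriv h) x) x := fun x =>
    (hC1.differentiable (by norm_num) x).hasDerivAt
  have hd2c : Continuous (deriv (deriv h)) := hC1.continuous_deriv le_rfl
  have hK : 0 < K := hk.trans hkK
  have hb2 : ∀ x, |deriv (deriv h) x| ≤ K := fun x =>
    abs_le.2 ⟨by linarith [hlb x], hub x⟩
  obtain ⟨a, ha, hb1⟩ : ∃ a, 0 ≤ a ∧ ∀ x, |deriv h x| ≤ a + K * |x| := by
    refine ⟨|deriv h 0|, abs_nonneg _, fun x => ?_⟩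
    have := abs_sub_le_of_abs_deriv_le (B := fun _ => K) hd2 monotoneOn_const hb2 x
    linarith [abs_sub_abs_le_abs_sub (deriv h x) (deriv h 0)]
  have hb0 : ∀ x, |h x| ≤ |h 0| + (a + K * |x|) * |x| := fun x => by
    have := abs_sub_le_of_abs_deriv_le (B := fun r => a + K * r) hd1
      (fun r _ s _ hrs => by dsimp only; gcongr) hb1 x
    linarith [abs_sub_abs_le_abs_sub (h x) (h 0)]
  obtain ⟨C, hg0, hg1, hg2⟩ : ∃ C, (∀ x, |h x| ≤ C * (1 + x ^ 2)) ∧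
      (∀ x, |deriv h x| ≤ C * (1 + x ^ 2)) ∧ ∀ x, |deriv (deriv h) x| ≤ C * (1 + x ^ 2) := by
    have h0' := abs_nonneg (h 0)
    have hx : ∀ x : ℝ, |x| ≤ 1 + x ^ 2 := fun x => by
      nlinarith [sq_abs x, sq_nonneg (|x| - 1), abs_nonneg x]
    refine ⟨|h 0| + a + K, fun x => ?_, fun x => ?_, fun x => ?_⟩
    · nlinarith [hb0 x, sq_abs x, mul_le_mul_of_nonneg_left (hx x) ha,
        mul_nonneg h0' (sq_nonneg x)]
    · nlinarith [hb1 x, mul_le_mul_of_nonneg_left (hx x) hK.le, mul_nonneg ha (sq_nonneg x),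
        mul_nonneg h0' (sq_nonneg x)]
    · nlinarith [hb2 x, mul_nonneg ha (sq_nonneg x), mul_nonneg h0' (sq_nonneg x),
        mul_nonneg hK.le (sq_nonneg x)]
  have hβ2 : β ^ 2 = 2 * ((N : ℝ) - 1) * α / N := by
    rw [hβ, Real.sq_sqrt (by positivity)]
  have hpN := pN_eq_brownianResolvent (by lia : 1 ≤ N) hα hC2.continuous hg0
  have hode := mul_brownianResolvent_eq hα hc hd1 hd2 hd2c hg0 hb1 hb2
  have hX : AEStronglyMeasurable (fun p : ℝ × ℝ => √(((N : ℝ) - 1) / N * p.1) * p.2)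
      ((volume.restrict (Ioi (0 : ℝ))).prod (gaussianReal 0 1)) := by fun_prop
  have hR1 : ∀ y, HasDerivAt (brownianResolvent (((N : ℝ) - 1) / N) α h)
      (brownianResolvent (((N : ℝ) - 1) / N) α (deriv h) y) y :=
    hasDerivAt_integral_mul_comp_add (integrable_exp_prod hα)
      (integrable_exp_mul_sq_prod hα hc.le) hX hd1 hC1.continuous hg0 hg1
  have hR2 : ∀ y, HasDerivAt (brownianResolvent (((N : ℝ) - 1) / N) α (deriv h))
      (brownianResolvent (((N : ℝ) - 1) / N) α (deriv (deriv h)) y) y :=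
    hasDerivAt_integral_mul_comp_add (integrable_exp_prod hα)
      (integrable_exp_mul_sq_prod hα hc.le) hX hd2 hd2c hg1 hg2
  have hR3 : Continuous (brownianResolvent (((N : ℝ) - 1) / N) α (deriv (deriv h))) :=
    continuous_integral_mul_comp_add (integrable_exp_prod hα) hX hd2c hb2
  set c : ℝ := ((N : ℝ) - 1) / N with hc_def
  have hlin : ∀ b y : ℝ, HasDerivAt (fun y => b * y) b y := fun b y => by
    simpa using (hasDerivAt_id y).const_mul b
  have hW1 : ∀ y, HasDerivAt (fun y => pN N α h y + A * cosh (β * y))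
      (c * brownianResolvent c α (deriv h) (c * y) + A * (β * sinh (β * y))) y := fun y => by
    simp only [hpN]
    have := ((hR1 (c * y)).comp y (hlin c y)).add (((hlin β y).cosh).const_mul A)
    convert! this using 1
    ring
  have hW2 : ∀ y, HasDerivAt
      (fun y => c * brownianResolvent c α (deriv h) (c * y) + A * (β * sinh (β * y)))
      (c ^ 2 * brownianResolvent c α (deriv (deriv h)) (c * y) + A * (β ^ 2 * cosh (β * y))) y :=
    fun y => by
      have := (((hR2 (c * y)).comp y (hlin c y)).const_mul c).add
        ((((hlin β y).sinh).const_mul β).const_mul A)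
      convert! this using 1
      ring
  subst hw
  refine ⟨?_, fun x => ?_⟩
  · have hxC : ContDiff ℝ 2 xtil := by
      rw [hxtil]
      fun_prop
    exact (contDiff_two_of_hasDerivAt hW1 hW2 (by fun_prop)).comp hxC
  · have hi : secondPartial (fun x => pN N α h (xtil x) + A * cosh (β * xtil x)) i x = _ :=
      secondPartial_comp_of_affine hW1 hW2 (l := xtil) (d := 1) fun t => by
        have : ∀ j ∈ Finset.univ.erase i, Function.update x i t j = x j := fun j hj =>
          Function.update_of_ne (Finset.ne_of_mem_erase hj) _ _
        simp only [hxtil, Function.update_self, Finset.sum_congr rfl this]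
        ring
    have hj : ∀ j ∈ Finset.univ.erase i,
        secondPartial (fun x => pN N α h (xtil x) + A * cosh (β * xtil x)) j x = _ := fun j hj =>
      secondPartial_comp_of_affine hW1 hW2 (l := xtil) (d := -1 / ((N : ℝ) - 1)) fun t => by
        have hupd : ∀ k ∈ (Finset.univ.erase i).erase j, Function.update x j t k = x k :=
          fun k hk => Function.update_of_ne (Finset.ne_of_mem_erase hk) _ _
        simp only [hxtil, Function.update_of_ne (Finset.ne_of_mem_erase hj).symm,
          ← Finset.add_sum_erase _ _ hj, Function.update_self, Finset.sum_congr rfl hupd]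
        ring
    rw [← Finset.add_sum_erase _ _ (Finset.mem_univ i), hi, Finset.sum_congr rfl hj,
      Finset.sum_const, Finset.card_erase_of_mem (Finset.mem_univ i), Finset.card_univ,
      Fintype.card_fin, nsmul_eq_mul, Nat.cast_sub (by lia : 1 ≤ N), Nat.cast_one, hβ2]
    simp only [hpN]
    have hode' : h (c * xtil x) = α * brownianResolvent c α h (c * xtil x)
        - c / 2 * brownianResolvent c α (deriv (deriv h)) (c * xtil x) := by
      linarith [hode (c * xtil x)]
    rw [hode']
    generalize brownianResolvent c α (deriv (deriv h)) (c * xtil x) = r₂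
    generalize brownianResolvent c α h (c * xtil x) = r₀
    rw [hc_def]
    field_simp
    ring
end

section
/- Under assumption H2', p_N'(x) > 0 for all x > 0 (and p_N'(x) ≥ 0 for x ≥ 0), and p_N'' is non-increasing on [0,∞). -/
open MeasureTheory Real Set Filter Topology ProbabilityTheory

section Parametric

variable {Ω : Type*} [MeasurableSpace Ω] {M : Measure Ω} [IsFiniteMeasure M] {Y : Ω → ℝ}

/-- A function of quadratic growth is integrable along an affine perturbation of a random
variable with finite second moment. -/
theorem integrable_comp_affine_of_quadratic_growth (hY : Measurable Y)
    (hY2 : Integrable (fun ω => Y ω ^ 2) M) {f : ℝ → ℝ} (hf : Continuous f) {A B : ℝ}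
    (hB : 0 ≤ B) (hfb : ∀ y, |f y| ≤ A + B * y ^ 2) (b : ℝ) :
    Integrable (fun ω => f (b + Y ω)) M := by
  have hbound : Integrable (fun ω => A + B * (2 * b ^ 2 + 2 * Y ω ^ 2)) M :=
    (integrable_const _).add (((integrable_const _).add (hY2.const_mul 2)).const_mul B)
  refine hbound.mono' (hf.measurable.comp (measurable_const.add hY)).aestronglyMeasurable ?_
  refine ae_of_all _ fun ω => (hfb _).trans ?_
  have : (b + Y ω) ^ 2 ≤ 2 * b ^ 2 + 2 * Y ω ^ 2 := by nlinarith [sq_nonneg (b - Y ω)]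
  gcongr

/-- Differentiation under the integral sign for `C¹` functions of quadratic growth. -/
theorem hasDerivAt_integral_comp_affine (hY : Measurable Y)
    (hY2 : Integrable (fun ω => Y ω ^ 2) M) {f : ℝ → ℝ} (hf : ContDiff ℝ 1 f) {A B A' B' : ℝ}
    (hB : 0 ≤ B) (hfb : ∀ y, |f y| ≤ A + B * y ^ 2)
    (hB' : 0 ≤ B') (hfb' : ∀ y, |deriv f y| ≤ A' + B' * y ^ 2) (c x : ℝ) :
    HasDerivAt (fun x => ∫ ω, f (c * x + Y ω) ∂M)
      (c * ∫ ω, deriv f (c * x + Y ω) ∂M) x := by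
  have hf' : Continuous (deriv f) := hf.continuous_deriv le_rfl
  have hd : Differentiable ℝ f := hf.differentiable one_ne_zero
  have hbound : Integrable
      (fun ω => |c| * (A' + B' * (2 * (c ^ 2 * (|x| + 1) ^ 2) + 2 * Y ω ^ 2))) M :=
    ((integrable_const _).add
      (((integrable_const _).add (hY2.const_mul 2)).const_mul B')).const_mul _
  have key := (hasDerivAt_integral_of_dominated_loc_of_deriv_le
    (F := fun x ω => f (c * x + Y ω)) (F' := fun x ω => c * deriv f (c * x + Y ω))
    (μ := M) (x₀ := x) (Metric.ball_mem_nhds x one_pos)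
    (Eventually.of_forall fun z =>
      (hf.continuous.measurable.comp (measurable_const.add hY)).aestronglyMeasurable)
    (integrable_comp_affine_of_quadratic_growth hY hY2 hf.continuous hB hfb _)
    ((hf'.measurable.comp (measurable_const.add hY)).const_mul c).aestronglyMeasurable
    (ae_of_all _ fun ω z hz => ?_) hbound (ae_of_all _ fun ω z _ => ?_)).2
  · rwa [integral_const_mul] at key
  · rw [norm_mul, Real.norm_eq_abs, Real.norm_eq_abs]
    have hz' : |z| ≤ |x| + 1 := by
      rw [Metric.mem_ball, Real.dist_eq] at hz
      have := abs_sub_abs_le_abs_sub z x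
      linarith
    have h1 : z ^ 2 ≤ (|x| + 1) ^ 2 := by
      rw [← sq_abs z]
      gcongr
    have h2 : (c * z + Y ω) ^ 2 ≤ 2 * (c ^ 2 * z ^ 2) + 2 * Y ω ^ 2 := by
      nlinarith [sq_nonneg (c * z - Y ω)]
    have h3 : (c * z + Y ω) ^ 2 ≤ 2 * (c ^ 2 * (|x| + 1) ^ 2) + 2 * Y ω ^ 2 := by
      refine h2.trans ?_
      gcongr
    refine mul_le_mul_of_nonneg_left ((hfb' _).trans ?_) (abs_nonneg c)
    gcongr
  · have h1 : HasDerivAt (fun z => c * z + Y ω) c z := by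
      simpa using ((hasDerivAt_id z).const_mul c).add_const (Y ω)
    have := (hd (c * z + Y ω)).hasDerivAt.comp z h1
    rwa [mul_comm] at this

end Parametric

theorem gaussianPDFReal_zero_le_of_sq_le (v : NNReal) {a b : ℝ} (hab : a ^ 2 ≤ b ^ 2) :
    gaussianPDFReal 0 v b ≤ gaussianPDFReal 0 v a := by
  simp only [gaussianPDFReal, sub_zero]
  gcongr

theorem gaussianPDFReal_zero_neg (v : NNReal) (a : ℝ) :
    gaussianPDFReal 0 v (-a) = gaussianPDFReal 0 v a := by
  simp [gaussianPDFReal]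

/-- Convolution with a centered Gaussian preserves bounded even functions which are
antitone on `[0, ∞)`. -/
theorem antitoneOn_integral_gaussianReal {g : ℝ → ℝ} (hg : Continuous g) {C : ℝ}
    (hC : ∀ x, |g x| ≤ C) (heven : ∀ x, g (-x) = g x) (hanti : AntitoneOn g (Ici 0))
    {v : NNReal} (hv : v ≠ 0) :
    AntitoneOn (fun x => ∫ u, g (x + u) ∂(gaussianReal 0 v)) (Ici 0) := by
  intro x hx y hy hxy
  have hx : 0 ≤ x := hx
  have habs : ∀ p q : ℝ, p ^ 2 ≤ q ^ 2 → g q ≤ g p := by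
    have hgabs : ∀ p, g |p| = g p := fun p => by
      rcases abs_choice p with h | h <;> simp [h, heven]
    intro p q hpq
    rw [← hgabs p, ← hgabs q]
    exact hanti (abs_nonneg p) (abs_nonneg q) (sq_le_sq.mp hpq)
  simp only [integral_gaussianReal_eq_integral_smul hv, smul_eq_mul]
  set φ := gaussianPDFReal 0 v
  have hφ : Integrable φ volume := integrable_gaussianPDFReal 0 v
  obtain ⟨a, ha⟩ : ∃ a, a = (x + y) / 2 := ⟨_, rfl⟩
  obtain ⟨d, hd⟩ : ∃ d, d = (y - x) / 2 := ⟨_, rfl⟩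
  have ha0 : 0 ≤ a := by linarith
  have hd0 : 0 ≤ d := by linarith
  have shift : ∀ F : ℝ → ℝ, ∫ u, F u = ∫ s, F (s - a) := fun F =>
    (integral_sub_right_eq_self F a).symm
  have flip : ∀ F : ℝ → ℝ, ∫ u, F u = ∫ s, F (-(s + a)) := fun F => by
    rw [← integral_neg_eq_self F volume]
    exact (integral_add_right_eq_self (fun u => F (-u)) a).symm
  have hint : ∀ r b : ℝ, Integrable (fun s => φ (s + r) * g (s + b)) volume := fun r b => by
    have := (hφ.comp_add_right r).bdd_mul (f := fun s => g (s + b)) (c := C)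
      (by fun_prop) (ae_of_all _ fun s => hC _)
    simpa only [mul_comm] using this
  have ey1 : ∫ u, φ u * g (y + u) = ∫ s, φ (s + -a) * g (s + d) := by
    rw [shift]
    congr! 3 with s
    rw [ha, hd]; ring_nf
  have ex1 : ∫ u, φ u * g (x + u) = ∫ s, φ (s + -a) * g (s + -d) := by
    rw [shift]
    congr! 3 with s
    rw [ha, hd]; ring_nf
  have ey2 : ∫ u, φ u * g (y + u) = ∫ s, φ (s + a) * g (s + -d) := by
    rw [flip]
    congr! 3 with s
    · exact gaussianPDFReal_zero_neg v _
    · rw [← heven]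
      congr 1
      rw [ha, hd]; ring
  have ex2 : ∫ u, φ u * g (x + u) = ∫ s, φ (s + a) * g (s + d) := by
    rw [flip]
    congr! 3 with s
    · exact gaussianPDFReal_zero_neg v _
    · rw [← heven]
      congr 1
      rw [ha, hd]; ring
  have hle : (∫ s, φ (s + -a) * g (s + d)) + ∫ s, φ (s + a) * g (s + -d)
      ≤ (∫ s, φ (s + -a) * g (s + -d)) + ∫ s, φ (s + a) * g (s + d) := by
    rw [← integral_add (hint _ _) (hint _ _), ← integral_add (hint _ _) (hint _ _)]
    refine integral_mono ((hint _ _).add (hint _ _)) ((hint _ _).add (hint _ _)) fun s => ?_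
    suffices 0 ≤ (φ (s + -a) - φ (s + a)) * (g (s + -d) - g (s + d)) by
      simp only
      linarith
    rcases le_total 0 s with hs | hs
    · refine mul_nonneg (sub_nonneg.2 (gaussianPDFReal_zero_le_of_sq_le v ?_))
        (sub_nonneg.2 (habs _ _ ?_))
      · nlinarith [mul_nonneg hs ha0]
      · nlinarith [mul_nonneg hs hd0]
    · refine mul_nonneg_of_nonpos_of_nonpos
        (sub_nonpos.2 (gaussianPDFReal_zero_le_of_sq_le v ?_)) (sub_nonpos.2 (habs _ _ ?_))
      · nlinarith [mul_nonneg (neg_nonneg.2 hs) ha0]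
      · nlinarith [mul_nonneg (neg_nonneg.2 hs) hd0]
  linarith

/-- A centered Gaussian integral as an integral against the standard Gaussian. -/
theorem integral_gaussianReal_zero_eq_standard {f : ℝ → ℝ} (hf : Continuous f) {s : ℝ}
    (hs : 0 ≤ s) :
    ∫ u, f u ∂(gaussianReal 0 s.toNNReal) = ∫ z, f (√s * z) ∂(gaussianReal 0 1) := by
  have hmap : (gaussianReal 0 1).map (fun z => √s * z) = gaussianReal 0 s.toNNReal := by
    rw [gaussianReal_map_const_mul, mul_zero, mul_one]
    congr 1
    ext
    simp [Real.sq_sqrt hs, hs]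
  rw [← hmap, integral_map (by fun_prop) hf.aestronglyMeasurable]

/-- The measure `e^{-αt} dt` on `(0, ∞)`. -/
noncomputable def discountMeasure (α : ℝ) : Measure ℝ :=
  (volume.restrict (Ioi 0)).withDensity fun t => ENNReal.ofReal (Real.exp (-α * t))

theorem integral_discountMeasure (α : ℝ) (F : ℝ → ℝ) :
    ∫ t, F t ∂(discountMeasure α) = ∫ t in Ioi (0:ℝ), Real.exp (-α * t) * F t := by
  rw [discountMeasure, integral_withDensity_eq_integral_toReal_smul (by fun_prop) (by simp)]
  simp [ENNReal.toReal_ofReal (Real.exp_nonneg _)]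

theorem isFiniteMeasure_discountMeasure {α : ℝ} (hα : 0 < α) :
    IsFiniteMeasure (discountMeasure α) :=
  isFiniteMeasure_withDensity_ofReal (exp_neg_integrableOn_Ioi 0 hα).2

theorem integrable_id_discountMeasure {α : ℝ} (hα : 0 < α) :
    Integrable (fun t => t) (discountMeasure α) := by
  rw [discountMeasure, integrable_withDensity_iff (by fun_prop) (by simp)]
  have := integrableOn_rpow_mul_exp_neg_mul_rpow (p := 1) (s := 1) (b := α) (by norm_num)
    one_pos hα
  simpa [IntegrableOn, ENNReal.toReal_ofReal (Real.exp_nonneg _)] using this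

theorem discountMeasure_ne_zero (α : ℝ) : discountMeasure α ≠ 0 := by
  rw [discountMeasure, Ne, withDensity_eq_zero_iff (by fun_prop)]
  intro h
  have : (ae (volume.restrict (Ioi (0:ℝ)))).NeBot := by
    rw [ae_neBot, Ne, Measure.restrict_eq_zero]
    simp
  obtain ⟨t, ht⟩ := h.exists
  exact (ENNReal.ofReal_pos.2 (Real.exp_pos _)).ne' ht

theorem ae_pos_discountMeasure (α : ℝ) : ∀ᵐ t ∂(discountMeasure α), 0 < t :=
  (withDensity_absolutelyContinuous _ _).ae_le (ae_restrict_mem measurableSet_Ioi)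

/-- A function vanishing at `0` with derivative bounded by `K` has linear growth. -/
theorem abs_le_mul_abs_of_abs_deriv_le {f : ℝ → ℝ} (hf : Differentiable ℝ f) (hf0 : f 0 = 0)
    {K : ℝ} (hK : ∀ x, |deriv f x| ≤ K) (y : ℝ) : |f y| ≤ K * |y| := by
  simpa [hf0] using Convex.norm_image_sub_le_of_norm_deriv_le (fun x _ => hf x)
    (fun x _ => hK x) convex_univ (mem_univ 0) (mem_univ y)

theorem abs_le_of_abs_deriv_le_mul_abs {f : ℝ → ℝ} (hf : Differentiable ℝ f)
    {K : ℝ} (hK0 : 0 ≤ K) (hK : ∀ x, |deriv f x| ≤ K * |x|) (y : ℝ) :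
    |f y| ≤ |f 0| + K * y ^ 2 := by
  have h := Convex.norm_image_sub_le_of_norm_deriv_le (s := Icc (-|y|) |y|) (C := K * |y|)
    (fun x _ => hf x)
    (fun x hx => (hK x).trans (mul_le_mul_of_nonneg_left (abs_le.2 hx) hK0))
    (convex_Icc _ _) (x := 0) (y := y) (by simp) (abs_le.1 le_rfl)
  have h2 : K * |y| * |y| = K * y ^ 2 := by rw [mul_assoc, ← sq, sq_abs]
  simp only [Real.norm_eq_abs, sub_zero, h2] at h
  linarith [abs_sub_abs_le_abs_sub (f y) (f 0)]

theorem deriv_neg_of_even {f : ℝ → ℝ} (hf : ∀ x, f (-x) = f x) (x : ℝ) :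
    deriv f (-x) = -deriv f x := by
  have := deriv_comp_neg f x
  rw [funext hf] at this
  linarith

theorem deriv_neg_of_odd {f : ℝ → ℝ} (hf : ∀ x, f (-x) = -f x) (x : ℝ) :
    deriv f (-x) = deriv f x := by
  have := deriv_comp_neg f x
  rw [funext hf, deriv.fun_neg] at this
  linarith

theorem pN_neg {h : ℝ → ℝ} (hc : Continuous h) (heven : ∀ x, h (-x) = h x) (N : ℕ) (α x : ℝ) :
    pN N α h (-x) = pN N α h x := by
  simp only [pN]
  congr! 3 with t
  generalize ((N:ℝ) - 1) / N = c
  have hmap := gaussianReal_map_neg (μ := 0) (v := (c * t).toNNReal)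
  rw [neg_zero] at hmap
  conv_lhs => rw [← hmap]
  rw [integral_map (by fun_prop) (by fun_prop)]
  congr! 2 with u
  rw [← heven]
  ring_nf

/-- Under H2', `p_N' > 0` on `(0,∞)` (and `p_N' ≥ 0` on `[0,∞)`), and `p_N''` is
non-increasing on `[0,∞)`. -/
theorem pN_deriv_monotonicity (N : ℕ) (hN : 2 ≤ N) (α k K : ℝ) (hα : 0 < α)
    (hk : 0 < k) (hkK : k < K) (h : ℝ → ℝ) (hC2 : ContDiff ℝ 2 h)
    (heven : ∀ x, h (-x) = h x) (h0 : 0 ≤ h 0)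
    (hmono : AntitoneOn (deriv (deriv h)) (Set.Ici 0))
    (hlb : ∀ x, k ≤ deriv (deriv h) x) (hub : ∀ x, deriv (deriv h) x ≤ K) :
    (∀ x : ℝ, 0 < x → 0 < deriv (pN N α h) x) ∧
    (∀ x : ℝ, 0 ≤ x → 0 ≤ deriv (pN N α h) x) ∧
    AntitoneOn (deriv (deriv (pN N α h))) (Set.Ici 0) := by
  obtain ⟨c, hcdef⟩ : ∃ c, c = ((N:ℝ) - 1) / N := ⟨_, rfl⟩
  have hc : 0 < c := by
    have : (2:ℝ) ≤ N := by exact_mod_cast hN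
    rw [hcdef]
    exact div_pos (by linarith) (by linarith)
  have hK : 0 < K := hk.trans hkK
  have hd1 : ContDiff ℝ 1 (deriv h) := hC2.deriv' (n := 1)
  have hd2 : Continuous (deriv (deriv h)) := hd1.continuous_deriv le_rfl
  have hodd := deriv_neg_of_even heven
  have hodd0 : deriv h 0 = 0 := by
    have := hodd 0
    rw [neg_zero] at this
    linarith
  have hb2 : ∀ y, |deriv (deriv h) y| ≤ K := fun y =>
    abs_le.2 ⟨by linarith [hlb y], hub y⟩
  have hb1 := abs_le_mul_abs_of_abs_deriv_le (hd1.differentiable one_ne_zero) hodd0 hb2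
  have hb0 := abs_le_of_abs_deriv_le_mul_abs (hC2.differentiable two_ne_zero) hK.le hb1
  have hb1' : ∀ y, |deriv h y| ≤ K + K * y ^ 2 := fun y => by
    refine (hb1 y).trans ?_
    nlinarith [sq_nonneg (|y| - 1), sq_abs y, abs_nonneg y]
  have hb2' : ∀ y, |deriv (deriv h) y| ≤ K + 0 * y ^ 2 := fun y => by simpa using hb2 y
  have := isFiniteMeasure_discountMeasure hα
  obtain ⟨M, hM⟩ : ∃ M, M = (discountMeasure α).prod (gaussianReal 0 1) := ⟨_, rfl⟩
  have : IsFiniteMeasure M := by rw [hM]; infer_instance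
  have hM0 : 0 < M.real univ := by
    have : NeZero (discountMeasure α) := ⟨discountMeasure_ne_zero α⟩
    have h1 : 0 < (discountMeasure α).real univ := measureReal_univ_pos
    have h2 : M.real univ = (discountMeasure α).real univ := by
      rw [hM, ← univ_prod_univ, measureReal_prod_prod]
      simp
    rwa [h2]
  obtain ⟨Y, hYdef⟩ : ∃ Y : ℝ × ℝ → ℝ, Y = fun p => √(c * p.1) * p.2 := ⟨_, rfl⟩
  have hY : Measurable Y := by rw [hYdef]; fun_prop
  have hpos : ∀ᵐ p ∂M, 0 < p.1 := by
    rw [hM]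
    exact Measure.quasiMeasurePreserving_fst.ae (ae_pos_discountMeasure α)
  have hY2 : Integrable (fun p => Y p ^ 2) M := by
    have hz : Integrable (fun z : ℝ => z ^ 2) (gaussianReal 0 1) := by
      simpa using (memLp_id_gaussianReal (μ := 0) (v := 1) 2).integrable_sq
    have h1 := ((integrable_id_discountMeasure hα).const_mul c).mul_prod hz
    rw [← hM] at h1
    refine h1.congr ?_
    filter_upwards [hpos] with p hp
    rw [hYdef]
    simp only
    rw [mul_pow, Real.sq_sqrt (by positivity)]
  have hp : pN N α h = fun x => ∫ p, h (c * x + Y p) ∂M := by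
    funext x
    have hi := integrable_comp_affine_of_quadratic_growth hY hY2 hC2.continuous hK.le hb0 (c * x)
    rw [hM] at hi ⊢
    rw [integral_prod _ hi, integral_discountMeasure, pN, ← hcdef]
    refine setIntegral_congr_fun measurableSet_Ioi fun t ht => ?_
    have ht : 0 < t := ht
    have hh := hC2.continuous
    simp only [hYdef]
    rw [integral_gaussianReal_zero_eq_standard (f := fun u => h (c * x + u)) (by fun_prop)
      (by positivity)]
  have hp1 : deriv (pN N α h) = fun x => c * ∫ p, deriv h (c * x + Y p) ∂M := by
    rw [hp]
    funext x
    exact (hasDerivAt_integral_comp_affine hY hY2 (hC2.of_le one_le_two) hK.le hb0 hK.le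
      hb1' c x).deriv
  have hp2 : deriv (deriv (pN N α h)) =
      fun x => c * (c * ∫ p, deriv (deriv h) (c * x + Y p) ∂M) := by
    rw [hp1]
    funext x
    exact ((hasDerivAt_integral_comp_affine hY hY2 hd1 hK.le hb1' le_rfl hb2' c x).const_mul
      c).deriv
  have hi2 : ∀ b, Integrable (fun p => deriv (deriv h) (b + Y p)) M :=
    integrable_comp_affine_of_quadratic_growth hY hY2 hd2 le_rfl hb2'
  have hsm : StrictMono (deriv (pN N α h)) := by
    refine strictMono_of_deriv_pos fun x => ?_
    rw [hp2]
    have h1 : k * M.real univ ≤ ∫ p, deriv (deriv h) (c * x + Y p) ∂M := by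
      have := integral_mono (integrable_const k) (hi2 (c * x)) fun p => hlb _
      rwa [integral_const, smul_eq_mul, mul_comm] at this
    have h2 := (mul_pos hk hM0).trans_le h1
    positivity
  have hp0 : deriv (pN N α h) 0 = 0 := by
    have := deriv_neg_of_even (pN_neg hC2.continuous heven N α) 0
    rw [neg_zero] at this
    linarith
  refine ⟨fun x hx => hp0 ▸ hsm hx, fun x hx => hp0 ▸ hsm.monotone hx, ?_⟩
  intro x hx y hy hxy
  have hx : 0 ≤ x := hx
  have hy : 0 ≤ y := hy
  rw [hp2]
  simp only
  refine mul_le_mul_of_nonneg_left (mul_le_mul_of_nonneg_left ?_ hc.le) hc.le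
  have hix := hi2 (c * x)
  have hiy := hi2 (c * y)
  rw [hM] at hix hiy ⊢
  rw [integral_prod _ hix, integral_prod _ hiy]
  refine integral_mono_ae hiy.integral_prod_left hix.integral_prod_left ?_
  filter_upwards [ae_pos_discountMeasure α] with t ht
  have hct : 0 < c * t := by positivity
  have hanti := antitoneOn_integral_gaussianReal hd2 hb2 (deriv_neg_of_odd hodd) hmono
    (v := (c * t).toNNReal) (by simpa using hct)
    (mem_Ici.2 (by positivity : 0 ≤ c * x)) (mem_Ici.2 (by positivity : 0 ≤ c * y))
    (mul_le_mul_of_nonneg_left hxy hc.le)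
  simp only at hanti
  rw [integral_gaussianReal_zero_eq_standard (f := fun u => deriv (deriv h) (c * x + u))
      (by fun_prop) hct.le,
    integral_gaussianReal_zero_eq_standard (f := fun u => deriv (deriv h) (c * y + u))
      (by fun_prop) hct.le] at hanti
  simpa only [hYdef] using hanti
end

section
/- Let c be the unique positive root of w·tanh(w) = 1, set β = √(2(N−1)α/N) and b := c/β, and define F : (0,b] → ℝ by F(x) = ∫_x^b (1 − tanh(β·z)/(β·z))^{−1} dz. Then the map z ↦ z − F(z) is continuous and strictly increasing on (0,b], tends to −∞ as z → 0+, and equals b at z = b; consequently, for every real r ≤ b there exists a unique z ∈ (0,b] with z − F(z) = r. -/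
open MeasureTheory Real Set Filter Topology

lemma Real.sinh_lt_self_mul_cosh {w : ℝ} (hw : 0 < w) : sinh w < w * cosh w := by
  have hderiv : ∀ x : ℝ, HasDerivAt (fun x : ℝ => x * cosh x - sinh x) (x * sinh x) x := by
    intro x
    refine (((hasDerivAt_id' x).mul (hasDerivAt_cosh x)).sub (hasDerivAt_sinh x)).congr_deriv ?_
    ring
  have hmono : StrictMonoOn (fun x : ℝ => x * cosh x - sinh x) (Ici 0) := by
    refine strictMonoOn_of_deriv_pos (convex_Ici 0)
      (fun x _ => (hderiv x).continuousAt.continuousWithinAt) fun x hx => ?_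
    rw [interior_Ici] at hx
    rw [(hderiv x).deriv]
    exact mul_pos hx (sinh_pos_iff.mpr hx)
  have h := hmono self_mem_Ici hw.le hw
  simp only [zero_mul, sinh_zero, sub_zero] at h
  linarith

lemma Real.tanh_lt_self {w : ℝ} (hw : 0 < w) : tanh w < w := by
  rw [tanh_eq_sinh_div_cosh, div_lt_iff₀ (cosh_pos w)]
  exact sinh_lt_self_mul_cosh hw

lemma Real.div_one_add_le_tanh {w : ℝ} (hw : 0 ≤ w) : w / (1 + w) ≤ tanh w := by
  rw [tanh_eq_sinh_div_cosh, div_le_div_iff₀ (by linarith) (cosh_pos w)]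
  have h1 : w ≤ sinh w := self_le_sinh_iff.mpr hw
  have h2 : exp (-w) ≤ 1 := exp_le_one_iff.mpr (by linarith)
  have h3 : cosh w - sinh w = exp (-w) := cosh_sub_sinh w
  nlinarith

lemma Real.one_sub_tanh_div_self_pos {w : ℝ} (hw : 0 < w) : 0 < 1 - tanh w / w := by
  rw [sub_pos, div_lt_one hw]
  exact tanh_lt_self hw

lemma Real.one_sub_tanh_div_self_le {w : ℝ} (hw : 0 < w) : 1 - tanh w / w ≤ w := by
  have h : 1 / (1 + w) ≤ tanh w / w := by
    rw [le_div_iff₀ hw, one_div_mul_eq_div]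
    exact div_one_add_le_tanh hw.le
  have h' : 1 - w ≤ 1 / (1 + w) := by
    rw [le_div_iff₀ (by linarith)]
    nlinarith
  linarith

lemma Real.continuous_tanh : Continuous tanh := by
  simp only [funext tanh_eq_sinh_div_cosh]
  exact continuous_sinh.div continuous_cosh fun x => (cosh_pos x).ne'

section PositiveIntegrand

variable {g : ℝ → ℝ} {b : ℝ}

lemma intervalIntegrable_of_continuousOn_Ioi (hg : ContinuousOn g (Ioi 0)) {x y : ℝ}
    (hx : 0 < x) (hy : 0 < y) : IntervalIntegrable g volume x y :=
  (hg.mono fun _ hz => (lt_min hx hy).trans_le hz.1).intervalIntegrable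

lemma continuousOn_sub_integral (hg : ContinuousOn g (Ioi 0)) :
    ContinuousOn (fun x => x - ∫ z in x..b, g z) (Ioc 0 b) := by
  intro x hx
  have hd := intervalIntegral.integral_hasDerivAt_left
    (intervalIntegrable_of_continuousOn_Ioi hg hx.1 (hx.1.trans_le hx.2))
    (hg.stronglyMeasurableAtFilter isOpen_Ioi x hx.1) (hg.continuousAt (Ioi_mem_nhds hx.1))
  exact (continuousAt_id.sub hd.continuousAt).continuousWithinAt

lemma strictMonoOn_sub_integral (hg : ContinuousOn g (Ioi 0)) (hpos : ∀ z, 0 < z → 0 < g z) :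
    StrictMonoOn (fun x => x - ∫ z in x..b, g z) (Ioc 0 b) := by
  intro x hx y hy hxy
  have hadd := intervalIntegral.integral_add_adjacent_intervals
    (intervalIntegrable_of_continuousOn_Ioi hg hx.1 hy.1)
    (intervalIntegrable_of_continuousOn_Ioi hg hy.1 (hy.1.trans_le hy.2))
  have hnonneg : 0 ≤ ∫ z in x..y, g z :=
    intervalIntegral.integral_nonneg hxy.le fun z hz => (hpos z (hx.1.trans_le hz.1)).le
  simp only
  linarith

lemma tendsto_sub_integral_atBot (hb : 0 < b) (hg : ContinuousOn g (Ioi 0)) {k : ℝ} (hk : 0 < k)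
    (hle : ∀ z, 0 < z → k * z⁻¹ ≤ g z) :
    Tendsto (fun x => x - ∫ z in x..b, g z) (𝓝[>] 0) atBot := by
  have hlog : Tendsto (fun x => b - k * log b + k * log x) (𝓝[>] 0) atBot :=
    tendsto_atBot_add_const_left _ _ (tendsto_log_nhdsGT_zero.const_mul_atBot hk)
  refine tendsto_atBot_mono' _ ?_ hlog
  filter_upwards [Ioc_mem_nhdsGT hb] with x hx
  have hcont : ContinuousOn (fun z : ℝ => k * z⁻¹) (Ioi 0) :=
    continuousOn_const.mul (continuousOn_inv₀.mono fun z hz => (mem_Ioi.mp hz).ne')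
  have hint : ∫ z in x..b, k * z⁻¹ ≤ ∫ z in x..b, g z :=
    intervalIntegral.integral_mono_on hx.2
      (intervalIntegrable_of_continuousOn_Ioi hcont hx.1 hb)
      (intervalIntegrable_of_continuousOn_Ioi hg hx.1 hb)
      fun z hz => hle z (hx.1.trans_le hz.1)
  rw [intervalIntegral.integral_const_mul, integral_inv_of_pos hx.1 hb,
    log_div hb.ne' hx.1.ne'] at hint
  linarith [hx.2]

end PositiveIntegrand

lemma StrictMonoOn.existsUnique_eq_of_tendsto_atBot {G : ℝ → ℝ} {b r : ℝ} (hb : 0 < b)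
    (hcont : ContinuousOn G (Ioc 0 b)) (hmono : StrictMonoOn G (Ioc 0 b))
    (hlim : Tendsto G (𝓝[>] 0) atBot) (hr : r ≤ G b) : ∃! z, z ∈ Ioc 0 b ∧ G z = r := by
  obtain ⟨a, har, ha⟩ := ((hlim.eventually_le_atBot r).and (Ioc_mem_nhdsGT hb)).exists
  obtain ⟨z, hz, rfl⟩ := intermediate_value_Icc ha.2
    (hcont.mono fun z hz => ⟨ha.1.trans_le hz.1, hz.2⟩) ⟨har, hr⟩
  have hz' : z ∈ Ioc 0 b := ⟨ha.1.trans_le hz.1, hz.2⟩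
  exact ⟨z, ⟨hz', rfl⟩, fun y hy => hmono.injOn hy.1 hz' hy.2⟩

/-- For the quadratic-cost threshold `F(x) = ∫_x^b (1 − tanh(βz)/(βz))⁻¹ dz`, the map
`z ↦ z − F(z)` is continuous and strictly increasing on `(0,b]`, tends to `−∞` as
`z → 0+`, equals `b` at `b`; hence for every `r ≤ b` there is a unique `z ∈ (0,b]`
with `z − F(z) = r`. -/
theorem jump_target_exists_unique (N : ℕ) (hN : 2 ≤ N) (α : ℝ) (hα : 0 < α)
    (β : ℝ) (hβ : β = Real.sqrt (2 * ((N:ℝ) - 1) * α / N))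
    (c : ℝ) (hc : 0 < c) (hc1 : c * Real.tanh c = 1)
    (b : ℝ) (hb : b = c / β)
    (F : ℝ → ℝ)
    (hF : F = fun x => ∫ z in x..b, (1 - Real.tanh (β * z) / (β * z))⁻¹) :
    ContinuousOn (fun z => z - F z) (Ioc (0:ℝ) b) ∧
    StrictMonoOn (fun z => z - F z) (Ioc (0:ℝ) b) ∧
    Tendsto (fun z => z - F z) (𝓝[>] 0) atBot ∧
    b - F b = b ∧
    (∀ r : ℝ, r ≤ b → ∃! z : ℝ, z ∈ Ioc (0:ℝ) b ∧ z - F z = r) := by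
  have hβ0 : 0 < β := by
    have hN' : (2 : ℝ) ≤ N := by exact_mod_cast hN
    rw [hβ]
    exact sqrt_pos.mpr (div_pos (mul_pos (by linarith) hα) (by linarith))
  have hb0 : 0 < b := hb ▸ div_pos hc hβ0
  have hpos : ∀ z, 0 < z → 0 < 1 - tanh (β * z) / (β * z) := fun z hz =>
    one_sub_tanh_div_self_pos (mul_pos hβ0 hz)
  have hg : ContinuousOn (fun z => (1 - tanh (β * z) / (β * z))⁻¹) (Ioi 0) := by
    have hlin : Continuous fun z : ℝ => β * z := continuous_const.mul continuous_id
    exact (continuousOn_const.sub ((continuous_tanh.comp hlin).continuousOn.div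
      hlin.continuousOn fun z hz => (mul_pos hβ0 hz).ne')).inv₀ fun z hz => (hpos z hz).ne'
  have hle : ∀ z, 0 < z → β⁻¹ * z⁻¹ ≤ (1 - tanh (β * z) / (β * z))⁻¹ := fun z hz => by
    rw [← mul_inv]
    exact inv_anti₀ (hpos z hz) (one_sub_tanh_div_self_le (mul_pos hβ0 hz))
  have hcont := continuousOn_sub_integral (b := b) hg
  have hmono := strictMonoOn_sub_integral (b := b) hg fun z hz => inv_pos.mpr (hpos z hz)
  have hlim := tendsto_sub_integral_atBot hb0 hg (inv_pos.mpr hβ0) hle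
  subst hF
  refine ⟨hcont, hmono, hlim, by simp, fun r hr => ?_⟩
  exact hmono.existsUnique_eq_of_tendsto_atBot hb0 hcont hlim (by simpa using hr)
end
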